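/- arXiv:0912.5091 — 5 statements merged into one kernel-verified Lean document; each statement's English description precedes it below -/
import Mathlib

section
/- Let (A;B;C;D) be base sequences BS(r,s). Then the quadruple of integer sequences ((A+B)/2 ⌢ 0_s ; (A-B)/2 ⌢ 0_s ; 0_r ⌢ (C+D)/2 ; 0_r ⌢ (C-D)/2), where arithmetic on sequences is componentwise, ⌢ denotes concatenation, and 0_d is the zero sequence of length d, is a set of T-sequences of length r+s: each of the four sequences has entries in {-1,0,1}, at each of the r+s positions exactly one of the four sequences has a nonzero entry, and the sum of their nonperiodic autocorrelations vanishes for every j ≥ 1. -/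
open Finset Matrix Kronecker

/-- Nonperiodic autocorrelation `N_X(j)` of a sequence of length `m` (0-indexed):
`N_X(j) = ∑_{k=0}^{m-j-1} x_k x_{k+j}`. -/
def autocorr (m : ℕ) (X : ℕ → ℤ) (j : ℕ) : ℤ :=
  ∑ k ∈ Finset.range (m - j), X k * X (k + j)

/-- A binary (±1) sequence of length `m`. -/
def IsBinarySeq (m : ℕ) (X : ℕ → ℤ) : Prop :=
  ∀ i < m, X i = 1 ∨ X i = -1

/-- Base sequences `BS(r,s)`: binary sequences `A, B` of length `r` and `C, D` of
length `s` whose nonperiodic autocorrelations sum to zero for all `j ≥ 1`. -/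
def IsBaseSeq (r s : ℕ) (A B C D : ℕ → ℤ) : Prop :=
  IsBinarySeq r A ∧ IsBinarySeq r B ∧ IsBinarySeq s C ∧ IsBinarySeq s D ∧
    ∀ j, 1 ≤ j →
      autocorr r A j + autocorr r B j + autocorr s C j + autocorr s D j = 0

/-- A Golay pair of length `g`. -/
def IsGolayPair (g : ℕ) (A B : ℕ → ℤ) : Prop :=
  IsBinarySeq g A ∧ IsBinarySeq g B ∧
    ∀ j, 1 ≤ j → autocorr g A j + autocorr g B j = 0

/-- Normal sequences `NS(n)`: base sequences in `BS(n+1,n)` whose first two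
sequences agree in the first `n` entries. -/
def IsNormalSeq (n : ℕ) (A B C D : ℕ → ℤ) : Prop :=
  IsBaseSeq (n + 1) n A B C D ∧ ∀ i < n, B i = A i

/-- Near-normal sequences `NN(n)`: base sequences in `BS(n+1,n)` with
`b_i = (-1)^(i-1) a_i` for `i = 1, …, n` (0-indexed: `B i = (-1)^i * A i`). -/
def IsNearNormalSeq (n : ℕ) (A B C D : ℕ → ℤ) : Prop :=
  IsBaseSeq (n + 1) n A B C D ∧ ∀ i < n, B i = (-1) ^ i * A i

/-- T-sequences of length `t`: four `{-1,0,1}`-sequences such that at every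
position exactly one of them is nonzero, and the sum of their nonperiodic
autocorrelations vanishes for all `j ≥ 1`. -/
def IsTSeq (t : ℕ) (T₁ T₂ T₃ T₄ : ℕ → ℤ) : Prop :=
  (∀ i < t, T₁ i ∈ ({-1, 0, 1} : Set ℤ)) ∧
  (∀ i < t, T₂ i ∈ ({-1, 0, 1} : Set ℤ)) ∧
  (∀ i < t, T₃ i ∈ ({-1, 0, 1} : Set ℤ)) ∧
  (∀ i < t, T₄ i ∈ ({-1, 0, 1} : Set ℤ)) ∧
  (∀ i < t,
    (T₁ i ≠ 0 ∧ T₂ i = 0 ∧ T₃ i = 0 ∧ T₄ i = 0) ∨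
    (T₁ i = 0 ∧ T₂ i ≠ 0 ∧ T₃ i = 0 ∧ T₄ i = 0) ∨
    (T₁ i = 0 ∧ T₂ i = 0 ∧ T₃ i ≠ 0 ∧ T₄ i = 0) ∨
    (T₁ i = 0 ∧ T₂ i = 0 ∧ T₃ i = 0 ∧ T₄ i ≠ 0)) ∧
  ∀ j, 1 ≤ j →
    autocorr t T₁ j + autocorr t T₂ j + autocorr t T₃ j + autocorr t T₄ j = 0

/-- An orthogonal design `OD(4d; d,d,d,d)`: four `4d × 4d` matrices with entries
in `{-1,0,1}`, pairwise disjoint supports covering every position, with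
`Aᵢ Aᵢᵀ = d·I` and `Aᵢ Aⱼᵀ + Aⱼ Aᵢᵀ = 0` for `i ≠ j`. -/
def IsOD (d : ℕ) (A : Fin 4 → Matrix (Fin (4 * d)) (Fin (4 * d)) ℤ) : Prop :=
  (∀ k i j, A k i j ∈ ({-1, 0, 1} : Set ℤ)) ∧
  (∀ i j, ∃! k : Fin 4, A k i j ≠ 0) ∧
  (∀ k, A k * (A k)ᵀ = (d : ℤ) • 1) ∧
  (∀ k l, k ≠ l → A k * (A l)ᵀ + A l * (A k)ᵀ = 0)

/-- Williamson-type matrices of order `w`: four pairwise amicable `±1` matrices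
with `∑ Wᵢ Wᵢᵀ = 4w·I`. -/
def IsWilliamsonType (w : ℕ) (W : Fin 4 → Matrix (Fin w) (Fin w) ℤ) : Prop :=
  (∀ k i j, W k i j = 1 ∨ W k i j = -1) ∧
  (∀ k l, W k * (W l)ᵀ = W l * (W k)ᵀ) ∧
  (∑ k, W k * (W k)ᵀ) = ((4 * w : ℕ) : ℤ) • 1

/-- A Hadamard matrix: a `±1` matrix `H` with `H Hᵀ = m·I`, where `m` is the
size of the (finite) index type. -/
def IsHadamardMatrix {n : Type*} [Fintype n] [DecidableEq n] (H : Matrix n n ℤ) : Prop :=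
  (∀ i j, H i j = 1 ∨ H i j = -1) ∧ H * Hᵀ = (Fintype.card n : ℤ) • 1

/-- Appending zeros does not change the autocorrelation. -/
theorem autocorr_append_zero (r s : ℕ) (X : ℕ → ℤ) (j : ℕ) :
    autocorr (r + s) (fun i => if i < r then X i else 0) j = autocorr r X j := by
  unfold autocorr
  rw [← Finset.sum_subset (Finset.range_mono (show r - j ≤ r + s - j by omega))]
  · refine Finset.sum_congr rfl fun k hk => ?_
    rw [Finset.mem_range] at hk
    simp only [if_pos (show k < r by omega), if_pos (show k + j < r by omega)]
  · intro k _ hk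
    rw [Finset.mem_range] at hk
    simp only [if_neg (show ¬ k + j < r by omega), mul_zero]

/-- Prepending zeros does not change the autocorrelation. -/
theorem autocorr_zero_append (r s : ℕ) (Y : ℕ → ℤ) (j : ℕ) :
    autocorr (r + s) (fun i => if i < r then 0 else Y (i - r)) j = autocorr s Y j := by
  unfold autocorr
  rcases le_total j s with hj | hj
  · rw [Nat.add_sub_assoc hj, Finset.sum_range_add, Finset.sum_eq_zero, zero_add]
    · refine Finset.sum_congr rfl fun k _ => ?_
      simp only [if_neg (show ¬ r + k < r by omega), if_neg (show ¬ r + k + j < r by omega),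
        show r + k - r = k by omega, show r + k + j - r = k + j by omega]
    · intro k hk
      simp only [if_pos (Finset.mem_range.mp hk), zero_mul]
  · rw [Nat.sub_eq_zero_of_le hj, Finset.sum_range_zero]
    refine Finset.sum_eq_zero fun k hk => ?_
    rw [Finset.mem_range] at hk
    simp only [if_pos (show k < r by omega), zero_mul]

/-- The half-sum and half-difference of two binary sequences together have half the total
autocorrelation of the two sequences. -/
theorem IsBinarySeq.two_mul_autocorr_half_add_half_sub {m : ℕ} {X Y : ℕ → ℤ}
    (hX : IsBinarySeq m X) (hY : IsBinarySeq m Y) (j : ℕ) :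
    2 * (autocorr m (fun i => (X i + Y i) / 2) j + autocorr m (fun i => (X i - Y i) / 2) j) =
      autocorr m X j + autocorr m Y j := by
  unfold autocorr
  rw [← Finset.sum_add_distrib, ← Finset.sum_add_distrib, Finset.mul_sum]
  refine Finset.sum_congr rfl fun k hk => ?_
  rw [Finset.mem_range] at hk
  rcases hX k (by omega) with h₁ | h₁ <;> rcases hY k (by omega) with h₂ | h₂ <;>
    rcases hX (k + j) (by omega) with h₃ | h₃ <;>
    rcases hY (k + j) (by omega) with h₄ | h₄ <;> simp [h₁, h₂, h₃, h₄]

/-- The half-sum and half-difference of two signs lie in `{-1, 0, 1}` and exactly one of them is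
nonzero. -/
theorem half_add_half_sub_of_sign {x y : ℤ} (hx : x = 1 ∨ x = -1) (hy : y = 1 ∨ y = -1) :
    (x + y) / 2 ∈ ({-1, 0, 1} : Set ℤ) ∧ (x - y) / 2 ∈ ({-1, 0, 1} : Set ℤ) ∧
      (((x + y) / 2 ≠ 0 ∧ (x - y) / 2 = 0) ∨ ((x + y) / 2 = 0 ∧ (x - y) / 2 ≠ 0)) := by
  rcases hx with rfl | rfl <;> rcases hy with rfl | rfl <;> norm_num

/-- From base sequences `BS(r,s)` one obtains T-sequences of
length `r + s` via `((A+B)/2, 0_s; (A-B)/2, 0_s; 0_r, (C+D)/2; 0_r, (C-D)/2)`. -/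
theorem base_seq_to_T_seq (r s : ℕ) (A B C D : ℕ → ℤ)
    (h : IsBaseSeq r s A B C D) :
    IsTSeq (r + s)
      (fun i => if i < r then (A i + B i) / 2 else 0)
      (fun i => if i < r then (A i - B i) / 2 else 0)
      (fun i => if i < r then 0 else (C (i - r) + D (i - r)) / 2)
      (fun i => if i < r then 0 else (C (i - r) - D (i - r)) / 2) := by
  obtain ⟨hA, hB, hC, hD, hN⟩ := h
  have hAB (i : ℕ) (hi : i < r) := half_add_half_sub_of_sign (hA i hi) (hB i hi)
  have hCD (i : ℕ) (hi : i < r + s) (hr : ¬ i < r) :=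
    half_add_half_sub_of_sign (hC (i - r) (by omega)) (hD (i - r) (by omega))
  refine ⟨fun i hi => ?_, fun i hi => ?_, fun i hi => ?_, fun i hi => ?_, fun i hi => ?_,
    fun j hj => ?_⟩
  iterate 4
    by_cases hr : i < r
    · simp only [if_pos hr, hAB i hr, Set.mem_insert_iff, Set.mem_singleton_iff, true_or, or_true]
    · simp only [if_neg hr, hCD i hi hr, Set.mem_insert_iff, Set.mem_singleton_iff, true_or,
        or_true]
  · by_cases hr : i < r
    · simpa [hr] using (hAB i hr).2.2
    · simpa [hr] using (hCD i hi hr).2.2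
  · rw [autocorr_append_zero r s (fun i => (A i + B i) / 2),
      autocorr_append_zero r s (fun i => (A i - B i) / 2),
      autocorr_zero_append r s (fun i => (C i + D i) / 2),
      autocorr_zero_append r s (fun i => (C i - D i) / 2)]
    linarith [hN j hj, hA.two_mul_autocorr_half_add_half_sub hB j,
      hC.two_mul_autocorr_half_add_half_sub hD j]
end

section
/- If there exists a Golay pair of length g, then there exist normal sequences NS(g); in particular, base sequences BS(g+1,g) exist. -/
open Finset Matrix Kronecker

/-- The sequence `X` of length `m` followed by the entry `c`. -/
def extendBy (m : ℕ) (X : ℕ → ℤ) (c : ℤ) (i : ℕ) : ℤ :=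
  if i < m then X i else c

lemma extendBy_of_lt {m i : ℕ} (X : ℕ → ℤ) (c : ℤ) (h : i < m) : extendBy m X c i = X i :=
  if_pos h

lemma isBinarySeq_extendBy {m : ℕ} {X : ℕ → ℤ} {c : ℤ} (hX : IsBinarySeq m X)
    (hc : c = 1 ∨ c = -1) : IsBinarySeq (m + 1) (extendBy m X c) := by
  intro i _
  unfold extendBy
  split_ifs with h
  exacts [hX i h, hc]

lemma autocorr_of_le {m j : ℕ} (X : ℕ → ℤ) (h : m ≤ j) : autocorr m X j = 0 := by
  simp [autocorr, Nat.sub_eq_zero_of_le h]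

lemma autocorr_extendBy {m j : ℕ} (X : ℕ → ℤ) (c : ℤ) (hj : 1 ≤ j) (hjm : j ≤ m) :
    autocorr (m + 1) (extendBy m X c) j = autocorr m X j + X (m - j) * c := by
  unfold autocorr
  rw [Nat.sub_add_comm hjm, Finset.sum_range_succ]
  congr 1
  · refine Finset.sum_congr rfl fun k hk => ?_
    have hk' := Finset.mem_range.mp hk
    rw [extendBy_of_lt X c (by omega), extendBy_of_lt X c (by omega)]
  · rw [extendBy_of_lt X c (by omega), Nat.sub_add_cancel hjm]
    simp [extendBy]

lemma autocorr_extendBy_one_add_neg_one {m j : ℕ} (X : ℕ → ℤ) (hj : 1 ≤ j) :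
    autocorr (m + 1) (extendBy m X 1) j + autocorr (m + 1) (extendBy m X (-1)) j
      = 2 * autocorr m X j := by
  rcases le_or_gt j m with hjm | hjm
  · rw [autocorr_extendBy X 1 hj hjm, autocorr_extendBy X (-1) hj hjm]
    ring
  · rw [autocorr_of_le _ hjm, autocorr_of_le _ hjm, autocorr_of_le _ hjm.le]
    norm_num

/-- A Golay pair `(A; B)` yields the normal sequences `(A,1; A,-1; B; B)`. -/
lemma IsGolayPair.isNormalSeq {g : ℕ} {A B : ℕ → ℤ} (h : IsGolayPair g A B) :
    IsNormalSeq g (extendBy g A 1) (extendBy g A (-1)) B B := by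
  obtain ⟨hA, hB, hAB⟩ := h
  refine ⟨⟨isBinarySeq_extendBy hA (Or.inl rfl), isBinarySeq_extendBy hA (Or.inr rfl), hB, hB,
    fun j hj => ?_⟩, fun i hi => ?_⟩
  · linarith [autocorr_extendBy_one_add_neg_one (m := g) A hj, hAB j hj]
  · rw [extendBy_of_lt A _ hi, extendBy_of_lt A _ hi]

/-- If a Golay pair of length `g` exists, then normal sequences
`NS(g)` exist; in particular, base sequences `BS(g+1, g)` exist. -/
theorem golay_exists_to_normal_exists (g : ℕ)
    (h : ∃ A B : ℕ → ℤ, IsGolayPair g A B) :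
    (∃ A B C D : ℕ → ℤ, IsNormalSeq g A B C D) ∧
    (∃ A B C D : ℕ → ℤ, IsBaseSeq (g + 1) g A B C D) := by
  obtain ⟨A, B, hAB⟩ := h
  exact ⟨⟨_, _, _, _, hAB.isNormalSeq⟩, ⟨_, _, _, _, hAB.isNormalSeq.1⟩⟩
end

section
/- (Yang multiplication, second form.) If near-normal sequences NN(l) exist and base sequences BS(r,s) exist, then T-sequences of length (2l+1)(r+s) exist. -/
open Finset Matrix Kronecker

open LaurentPolynomial

lemma T_mul_T_neg (k : ℤ) : (T k : ℤ[T;T⁻¹]) * T (-k) = 1 := by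
  rw [← T_add, add_neg_cancel, T_zero]

/-- The Laurent polynomial `∑_{i<m} X_i T^{d i}` attached to a sequence `X` of length `m`. -/
noncomputable def seqPoly (d m : ℕ) (X : ℕ → ℤ) : ℤ[T;T⁻¹] :=
  ∑ i ∈ range m, (X i : ℤ[T;T⁻¹]) * T ((d * i : ℕ) : ℤ)

lemma invert_seqPoly (d m : ℕ) (X : ℕ → ℤ) :
    invert (seqPoly d m X) = ∑ i ∈ range m, (X i : ℤ[T;T⁻¹]) * T (-((d * i : ℕ) : ℤ)) := by
  simp [seqPoly, map_sum, map_mul]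

lemma autocorr_eq_zero_of_le {m j : ℕ} (h : m ≤ j) (X : ℕ → ℤ) : autocorr m X j = 0 := by
  simp [autocorr, Nat.sub_eq_zero_of_le h]

lemma autocorr_succ (m : ℕ) (X : ℕ → ℤ) (j : ℕ) :
    autocorr (m + 1) X j = autocorr m X j + if j ≤ m then X (m - j) * X m else 0 := by
  unfold autocorr
  split_ifs with h
  · rw [Nat.succ_sub h, sum_range_succ, Nat.sub_add_cancel h]
  · rw [Nat.sub_eq_zero_of_le (by lia), Nat.sub_eq_zero_of_le (by lia)]
    simp

/-- The norm of `seqPoly d m X` collects the autocorrelations of `X`. -/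
lemma seqPoly_mul_invert (d M m : ℕ) (X : ℕ → ℤ) (hM : m ≤ M) :
    seqPoly d m X * invert (seqPoly d m X) =
      ((∑ i ∈ range m, X i ^ 2 : ℤ) : ℤ[T;T⁻¹]) +
        ∑ j ∈ range M, (autocorr m X (j + 1) : ℤ[T;T⁻¹]) *
          (T ((d * (j + 1) : ℕ) : ℤ) + T (-((d * (j + 1) : ℕ) : ℤ))) := by
  induction m with
  | zero => simp [seqPoly, autocorr]
  | succ m ih =>
    have key : ∑ j ∈ range M, ((if j + 1 ≤ m then X (m - (j + 1)) * X m else 0 : ℤ) : ℤ[T;T⁻¹]) *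
          (T ((d * (j + 1) : ℕ) : ℤ) + T (-((d * (j + 1) : ℕ) : ℤ))) =
        (seqPoly d m X * T (-((d * m : ℕ) : ℤ)) +
          invert (seqPoly d m X) * T ((d * m : ℕ) : ℤ)) * (X m : ℤ[T;T⁻¹]) := by
      have h1 : ∑ j ∈ range M,
          ((if j + 1 ≤ m then X (m - (j + 1)) * X m else 0 : ℤ) : ℤ[T;T⁻¹]) *
            (T ((d * (j + 1) : ℕ) : ℤ) + T (-((d * (j + 1) : ℕ) : ℤ))) =
          ∑ j ∈ range m, ((X (m - 1 - j) * X m : ℤ) : ℤ[T;T⁻¹]) *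
            (T ((d * (j + 1) : ℕ) : ℤ) + T (-((d * (j + 1) : ℕ) : ℤ))) := by
        rw [← sum_subset (range_subset_range.2 (by lia : m ≤ M))]
        · refine sum_congr rfl fun j hj => ?_
          rw [mem_range] at hj
          rw [if_pos (by lia), show m - (j + 1) = m - 1 - j by lia]
        · intro j _ hj
          rw [mem_range] at hj
          rw [if_neg (by lia)]
          simp
      rw [h1, ← sum_range_reflect, invert_seqPoly, seqPoly, sum_mul, sum_mul, ← sum_add_distrib,
        sum_mul]
      refine sum_congr rfl fun j hj => ?_
      rw [mem_range] at hj
      rw [show m - 1 - (m - 1 - j) = j by lia, show m - 1 - j + 1 = m - j by lia,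
        mul_assoc _ (T _) (T _), mul_assoc _ (T _) (T _), ← T_add, ← T_add]
      have e : ((d * (m - j) : ℕ) : ℤ) = (d * m : ℕ) - (d * j : ℕ) := by
        push_cast [Nat.cast_sub hj.le]; ring
      rw [e, show -(((d * m : ℕ) : ℤ) - (d * j : ℕ)) = (d * j : ℕ) + -((d * m : ℕ) : ℤ) by ring,
        show ((d * m : ℕ) : ℤ) - (d * j : ℕ) = -((d * j : ℕ) : ℤ) + (d * m : ℕ) by ring]
      push_cast
      ring
    have hT : (T ((d * m : ℕ) : ℤ) : ℤ[T;T⁻¹]) * T (-((d * m : ℕ) : ℤ)) = 1 :=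
      T_mul_T_neg _
    simp only [autocorr_succ, Int.cast_add, add_mul, sum_add_distrib] at key ⊢
    rw [key, sum_range_succ]
    have hs : seqPoly d (m + 1) X = seqPoly d m X + (X m : ℤ[T;T⁻¹]) * T ((d * m : ℕ) : ℤ) := by
      rw [seqPoly, sum_range_succ, ← seqPoly]
    have ih := ih (by lia)
    rw [hs, map_add, map_mul, invert_T, map_intCast]
    push_cast at ih hT ⊢
    linear_combination ih + (X m : ℤ[T;T⁻¹]) ^ 2 * hT

/-- Four sequences have vanishing total autocorrelation if the sum of the norms of their
Laurent polynomials is constant. -/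
lemma autocorr_sum_eq_zero (m : ℕ) (X : Fin 4 → ℕ → ℤ) (c : ℤ)
    (h : ∑ k, seqPoly 1 m (X k) * invert (seqPoly 1 m (X k)) = (c : ℤ[T;T⁻¹]))
    (j : ℕ) (hj : 1 ≤ j) : ∑ k, autocorr m (X k) j = 0 := by
  obtain ⟨j, rfl⟩ := Nat.exists_eq_add_of_le' hj
  rcases le_or_gt m j with hm | hm
  · simp [autocorr_eq_zero_of_le (show m ≤ j + 1 by lia)]
  have hc := congrArg (fun p : ℤ[T;T⁻¹] => p.coeff ((j + 1 : ℕ) : ℤ)) h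
  have coeff_C : ∀ (x n : ℤ), ((x : ℤ[T;T⁻¹])).coeff n = if n = 0 then x else 0 := by
    intro x n
    rw [← C_apply, eq_intCast C]
  have coeff_CT : ∀ (x k n : ℤ), ((x : ℤ[T;T⁻¹]) * T k).coeff n = if k = n then x else 0 := by
    intro x k n
    rw [← eq_intCast C x, ← single_eq_C_mul_T, AddMonoidAlgebra.coeff_single, Finsupp.single_apply]
  simp only [seqPoly_mul_invert 1 m m _ le_rfl, sum_add_distrib, mul_add,
    AddMonoidAlgebra.coeff_add, AddMonoidAlgebra.coeff_sum, Finsupp.add_apply,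
    Finsupp.finsetSum_apply, coeff_C, coeff_CT, one_mul, Nat.cast_inj] at hc
  simpa [show ∀ x : ℕ, ¬ (-1 + -(x : ℤ) = j + 1) by lia, hm, show (j : ℤ) + 1 ≠ 0 by lia] using hc

/-- The sum of the norms is constant for sequences with vanishing total autocorrelation. -/
lemma seqPoly_norm_sum (d M : ℕ) (m : Fin 4 → ℕ) (X : Fin 4 → ℕ → ℤ)
    (hM : ∀ k, m k ≤ M) (h : ∀ j, 1 ≤ j → ∑ k, autocorr (m k) (X k) j = 0) :
    ∑ k, seqPoly d (m k) (X k) * invert (seqPoly d (m k) (X k)) =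
      ((∑ k, ∑ i ∈ range (m k), X k i ^ 2 : ℤ) : ℤ[T;T⁻¹]) := by
  simp only [fun k => seqPoly_mul_invert d M (m k) (X k) (hM k)]
  rw [sum_add_distrib, sum_comm]
  have : ∀ j, ∑ k, (autocorr (m k) (X k) (j + 1) : ℤ[T;T⁻¹]) = 0 := fun j => by
    rw [← Int.cast_sum, h (j + 1) (by lia), Int.cast_zero]
  simp only [← sum_mul, this, zero_mul, sum_const_zero, add_zero, Int.cast_sum]

/-- Yang's Lagrange identity, twisted by units `p₁, …, q₄`. Primed variables stand for
conjugates. -/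
lemma yang_lagrange_identity {R : Type*} [CommRing R]
    {a b c d e f g h a' b' c' d' e' f' g' h' : R}
    {p₁ p₂ p₃ p₄ q₁ q₂ q₃ q₄ p₁' p₂' p₃' p₄' q₁' q₂' q₃' q₄' : R}
    (hp₁ : p₁ * p₁' = 1) (hp₂ : p₂ * p₂' = 1) (hp₃ : p₃ * p₃' = 1) (hp₄ : p₄ * p₄' = 1)
    (hq₁ : q₁ * q₁' = 1) (hq₂ : q₂ * q₂' = 1) (hq₃ : q₃ * q₃' = 1) (hq₄ : q₄ * q₄' = 1)
    (h₁ : p₁ * p₃' = q₁ * q₃') (h₁' : p₁' * p₃ = q₁' * q₃)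
    (h₂ : p₁ * p₄' = q₂ * q₃') (h₂' : p₁' * p₄ = q₂' * q₃)
    (h₃ : p₂ * p₃' = q₄ * q₂') (h₃' : p₂' * p₃ = q₄' * q₂)
    (h₄ : p₂ * p₄' = q₄ * q₁') (h₄' : p₂' * p₄ = q₄' * q₁) :
    (p₁ * f' * a - p₂ * e * b' + p₃ * (g * c + h * d)) *
        (p₁' * f * a' - p₂' * e' * b + p₃' * (g' * c' + h' * d')) +
      (p₁ * f' * b + p₂ * e * a' + p₄ * (g' * d - h' * c)) *
        (p₁' * f * b' + p₂' * e' * a + p₄' * (g * d' - h * c')) +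
      (q₁ * g' * a - q₂ * h * b - q₃ * f * c - q₄ * e * d') *
        (q₁' * g * a' - q₂' * h' * b' - q₃' * f' * c' - q₄' * e' * d) +
      (q₂ * g * b + q₁ * h' * a - q₃ * f * d + q₄ * e * c') *
        (q₂' * g' * b' + q₁' * h * a' - q₃' * f' * d' + q₄' * e' * c) =
      (a * a' + b * b' + c * c' + d * d') * (e * e' + f * f' + g * g' + h * h') := by
  linear_combination
    f * f' * (a * a' + b * b') * hp₁ + e * e' * (a * a' + b * b') * hp₂ +
    (g * g' * c * c' + h * h' * d * d' + g * c * h' * d' + g' * c' * h * d) * hp₃ +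
    (g * g' * d * d' + h * h' * c * c' - g' * d * h * c' - g * d' * h' * c) * hp₄ +
    (g * g' + h * h') * a * a' * hq₁ + (g * g' + h * h') * b * b' * hq₂ +
    f * f' * (c * c' + d * d') * hq₃ + e * e' * (c * c' + d * d') * hq₄ +
    f' * a * (g' * c' + h' * d') * h₁ + f * a' * (g * c + h * d) * h₁' +
    f' * b * (g * d' - h * c') * h₂ + f * b' * (g' * d - h' * c) * h₂' -
    e * b' * (g' * c' + h' * d') * h₃ - e' * b * (g * c + h * d) * h₃' +
    e * a' * (g * d' - h * c') * h₄ + e' * a * (g' * d - h' * c) * h₄'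

/-- Exactly one of `x, y` is nonzero, and it is `±1`. -/
def UnitPair (x y : ℤ) : Prop :=
  (IsUnit x ∧ y = 0) ∨ (x = 0 ∧ IsUnit y)

/-- Exactly one of `x, y, z, w` is nonzero, and it is `±1`. -/
def UnitQuadruple (x y z w : ℤ) : Prop :=
  (UnitPair x y ∧ z = 0 ∧ w = 0) ∨ (x = 0 ∧ y = 0 ∧ UnitPair z w)

lemma isTSeq_of_unitQuadruple {t : ℕ} {X : Fin 4 → ℕ → ℤ}
    (hX : ∀ i < t, UnitQuadruple (X 0 i) (X 1 i) (X 2 i) (X 3 i))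
    (h : ∀ j, 1 ≤ j → ∑ k, autocorr t (X k) j = 0) : IsTSeq t (X 0) (X 1) (X 2) (X 3) := by
  simp only [Fin.sum_univ_four] at h
  simp only [UnitQuadruple, UnitPair, Int.isUnit_iff] at hX
  simp only [IsTSeq, Set.mem_insert_iff, Set.mem_singleton_iff]
  refine ⟨?_, ?_, ?_, ?_, ?_, h⟩ <;> intro i hi <;> have := hX i hi <;> lia

/-- The coefficients a Yang multiplier may assign to one block: either one of `f, e` is `±1` and all
others vanish, or `f` and `e` vanish and the pairs `g, h` and `g', h'` each have exactly one nonzero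
entry, equal to `±1` and in the same position. -/
def SlotCondition (f e g g' h h' : ℤ) : Prop :=
  (UnitPair f e ∧ g = 0 ∧ g' = 0 ∧ h = 0 ∧ h' = 0) ∨
    (f = 0 ∧ e = 0 ∧ UnitPair g h ∧ UnitPair g' h' ∧ (g = 0 ↔ g' = 0))

lemma SlotCondition.unitQuadruple {f e g g' h h' x y x' y' : ℤ}
    (hs : SlotCondition f e g g' h h') (hxy : UnitPair x y) (hxy' : UnitPair x' y') :
    UnitQuadruple (f * x - e * y') (f * y + e * x') (g * x - h * y) (g' * y + h' * x) := by
  simp only [SlotCondition, UnitPair, UnitQuadruple, Int.isUnit_iff] at *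
  rcases hs with ⟨⟨rfl | rfl, rfl⟩ | ⟨rfl, rfl | rfl⟩, rfl, rfl, rfl, rfl⟩ |
    ⟨rfl, rfl, ⟨rfl | rfl, rfl⟩ | ⟨rfl, rfl | rfl⟩, ⟨rfl | rfl, rfl⟩ | ⟨rfl, rfl | rfl⟩, hg⟩ <;>
  lia

lemma SlotCondition.unitQuadruple' {f e g g' h h' x y x' y' : ℤ}
    (hs : SlotCondition f e g g' h h') (hxy : UnitPair x y) (hxy' : UnitPair x' y') :
    UnitQuadruple (g * x + h * y) (g' * y - h' * x) (-(f * x) - e * y') (-(f * y) + e * x') := by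
  simp only [SlotCondition, UnitPair, UnitQuadruple, Int.isUnit_iff] at *
  rcases hs with ⟨⟨rfl | rfl, rfl⟩ | ⟨rfl, rfl | rfl⟩, rfl, rfl, rfl, rfl⟩ |
    ⟨rfl, rfl, ⟨rfl | rfl, rfl⟩ | ⟨rfl, rfl | rfl⟩, ⟨rfl | rfl, rfl⟩ | ⟨rfl, rfl | rfl⟩, hg⟩ <;>
  lia

/-- Concatenation of blocks of length `r + s`, where the block with index `β` consists of
`P β 0, …, P β (r-1), Q β 0, …, Q β (s-1)`. -/
def blockSeq (r s : ℕ) (P Q : ℕ → ℕ → ℤ) (k : ℕ) : ℤ :=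
  if k % (r + s) < r then P (k / (r + s)) (k % (r + s))
  else Q (k / (r + s)) (k % (r + s) - r)

lemma seqPoly_blockSeq (r s N : ℕ) (P Q : ℕ → ℕ → ℤ) :
    seqPoly 1 (N * (r + s)) (blockSeq r s P Q) =
      ∑ β ∈ range N, T (((r + s) * β : ℕ) : ℤ) *
        (seqPoly 1 r (P β) + T (r : ℤ) * seqPoly 1 s (Q β)) := by
  induction N with
  | zero => simp [seqPoly]
  | succ N ih =>
    rw [sum_range_succ, ← ih, seqPoly, Nat.succ_mul, sum_range_add, ← seqPoly, sum_range_add]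
    congr 1
    rw [mul_add (T _), seqPoly, seqPoly, mul_sum, mul_sum, mul_sum]
    congr 1 <;> refine sum_congr rfl fun i hi => ?_ <;> rw [mem_range] at hi
    · have h1 : (N * (r + s) + i) % (r + s) = i := by
        rw [Nat.mul_add_mod_self_right, Nat.mod_eq_of_lt (by lia)]
      have h2 : (N * (r + s) + i) / (r + s) = N := by
        rw [mul_comm, Nat.mul_add_div (by lia), Nat.div_eq_of_lt (by lia), add_zero]
      rw [blockSeq, h1, h2, if_pos hi, mul_left_comm, ← T_add]
      congr 2
      push_cast
      ring
    · have h1 : (N * (r + s) + (r + i)) % (r + s) = r + i := by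
        rw [Nat.mul_add_mod_self_right, Nat.mod_eq_of_lt (by lia)]
      have h2 : (N * (r + s) + (r + i)) / (r + s) = N := by
        rw [mul_comm, Nat.mul_add_div (by lia), Nat.div_eq_of_lt (by lia), add_zero]
      rw [blockSeq, h1, h2, if_neg (by lia), Nat.add_sub_cancel_left, ← mul_assoc (T _) (T _),
        ← T_add, mul_left_comm, ← T_add]
      congr 2
      push_cast
      ring

lemma seqPoly_reverse (d m : ℕ) (X : ℕ → ℤ) :
    seqPoly d m (fun i => X (m - 1 - i)) =
      T ((d : ℤ) * (m - 1)) * invert (seqPoly d m X) := by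
  rw [seqPoly, ← sum_range_reflect, invert_seqPoly, mul_sum]
  refine sum_congr rfl fun i hi => ?_
  rw [mem_range] at hi
  rw [mul_left_comm, ← T_add, show m - 1 - (m - 1 - i) = i by lia]
  congr 2
  push_cast [show m - 1 - i = m - (1 + i) by lia, Nat.cast_sub (show 1 + i ≤ m by lia)]
  ring

lemma seqPoly_linear (d m : ℕ) (x y : ℤ) (X Y : ℕ → ℤ) :
    seqPoly d m (fun i => x * X i + y * Y i) =
      (x : ℤ[T;T⁻¹]) * seqPoly d m X + (y : ℤ[T;T⁻¹]) * seqPoly d m Y := by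
  rw [seqPoly, seqPoly, seqPoly, mul_sum, mul_sum, ← sum_add_distrib]
  refine sum_congr rfl fun i _ => ?_
  push_cast
  ring

lemma seqPoly_blockSeq_linear (r s N : ℕ) (x y z w : ℕ → ℤ) (X Y Z W : ℕ → ℤ) :
    seqPoly 1 (N * (r + s)) (blockSeq r s (fun β i => x β * X i + y β * Y i)
        (fun β i => z β * Z i + w β * W i)) =
      seqPoly (r + s) N x * seqPoly 1 r X + seqPoly (r + s) N y * seqPoly 1 r Y +
        T (r : ℤ) * (seqPoly (r + s) N z * seqPoly 1 s Z +
          seqPoly (r + s) N w * seqPoly 1 s W) := by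
  simp only [seqPoly_blockSeq, seqPoly_linear]
  have unfold_coeff (x : ℕ → ℤ) : seqPoly (r + s) N x =
      ∑ β ∈ range N, (x β : ℤ[T;T⁻¹]) * T (((r + s) * β : ℕ) : ℤ) := rfl
  rw [unfold_coeff x, unfold_coeff y, unfold_coeff z, unfold_coeff w, sum_mul, sum_mul, sum_mul,
    sum_mul, ← sum_add_distrib, ← sum_add_distrib, mul_sum, ← sum_add_distrib]
  refine sum_congr rfl fun β _ => ?_
  ring

/-- Block coefficients by which base sequences `BS(r,s)` are multiplied to `T`-sequences of
length `N (r+s)`. The subscripts `A` and `C` refer to the part of a block in which elements of the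
sequences of length `r`, respectively `s`, are placed. -/
structure YangMultiplier (N : ℕ) where
  (fA eA gA gA' hA hA' fC eC gC gC' hC hC' : ℕ → ℤ)
  (p q : ℤ)
  slotA : ∀ β < N, SlotCondition (fA β) (eA β) (gA β) (gA' β) (hA β) (hA' β)
  slotC : ∀ β < N, SlotCondition (fC β) (eC β) (gC β) (gC' β) (hC β) (hC' β)
  poly_fA : ∀ n, seqPoly n N fA = T (n * p) * invert (seqPoly n N fC)
  poly_eA : ∀ n, seqPoly n N eA = T (n * q) * seqPoly n N eC
  poly_gA : ∀ n, seqPoly n N gA = T (n * p) * invert (seqPoly n N gC)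
  poly_hA' : ∀ n, seqPoly n N hA' = T (n * p) * invert (seqPoly n N hC)
  poly_gA' : ∀ n, seqPoly n N gA' = T (n * (1 - q)) * seqPoly n N gC
  poly_hA : ∀ n, seqPoly n N hA = T (n * (1 - q)) * seqPoly n N hC
  poly_gC' : ∀ n, seqPoly n N gC' = T (n * (p + q - 1)) * invert (seqPoly n N gC)
  poly_hC' : ∀ n, seqPoly n N hC' = T (n * (p + q - 1)) * invert (seqPoly n N hC)
  norm : ∀ n, ∃ c : ℤ, seqPoly n N eC * invert (seqPoly n N eC) +
    seqPoly n N fC * invert (seqPoly n N fC) + seqPoly n N gC * invert (seqPoly n N gC) +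
    seqPoly n N hC * invert (seqPoly n N hC) = (c : ℤ[T;T⁻¹])

/-- Half-sum and half-difference of two binary sequences. -/
lemma exists_half_sum_diff {m : ℕ} {A B : ℕ → ℤ} (hA : IsBinarySeq m A) (hB : IsBinarySeq m B) :
    ∃ a b : ℕ → ℤ, (∀ i < m, A i = a i + b i) ∧ (∀ i < m, B i = a i - b i) ∧
      (∀ i < m, UnitPair (a i) (b i)) ∧
      ∀ j, autocorr m A j + autocorr m B j = 2 * (autocorr m a j + autocorr m b j) := by
  obtain ⟨a, b, ha, hb, hab⟩ : ∃ a b : ℕ → ℤ, (∀ i < m, A i = a i + b i) ∧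
      (∀ i < m, B i = a i - b i) ∧ ∀ i < m, UnitPair (a i) (b i) := by
    refine ⟨fun i => (A i + B i) / 2, fun i => (A i - B i) / 2, ?_, ?_, ?_⟩ <;> intro i hi <;>
      rcases hA i hi with h | h <;> rcases hB i hi with h' | h' <;> simp [h, h', UnitPair]
  refine ⟨a, b, ha, hb, hab, fun j => ?_⟩
  simp only [autocorr]
  rw [← sum_add_distrib, ← sum_add_distrib, mul_sum]
  refine sum_congr rfl fun k hk => ?_
  rw [mem_range] at hk
  rw [ha k (by lia), hb k (by lia), ha (k + j) (by lia), hb (k + j) (by lia)]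
  ring

lemma YangMultiplier.exists_isTSeq {N : ℕ} (M : YangMultiplier N) {r s : ℕ}
    (hBS : ∃ A B C D : ℕ → ℤ, IsBaseSeq r s A B C D) :
    ∃ T₁ T₂ T₃ T₄ : ℕ → ℤ, IsTSeq (N * (r + s)) T₁ T₂ T₃ T₄ := by
  obtain ⟨A, B, C, D, hA, hB, hC, hD, hABCD⟩ := hBS
  obtain ⟨a, b, -, -, hab, hab'⟩ := exists_half_sum_diff hA hB
  obtain ⟨c, d, -, -, hcd, hcd'⟩ := exists_half_sum_diff hC hD
  have hbase : ∀ j, 1 ≤ j →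
      ∑ k, autocorr (![r, r, s, s] k) (![a, b, c, d] k) j = 0 := fun j hj => by
    have := hABCD j hj
    have := hab' j
    have := hcd' j
    simp only [Fin.sum_univ_four, Matrix.cons_val]
    lia
  have hnorm := seqPoly_norm_sum 1 (r + s) ![r, r, s, s] ![a, b, c, d]
    (fun k => by fin_cases k <;> simp) hbase
  generalize (∑ k, ∑ i ∈ range (![r, r, s, s] k), ![a, b, c, d] k i ^ 2) = w at hnorm
  obtain ⟨v, hv⟩ := M.norm (r + s)
  simp only [Fin.sum_univ_four, Matrix.cons_val] at hnorm
  let X : Fin 4 → ℕ → ℤ := ![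
    blockSeq r s (fun β i => M.fA β * a i + (-M.eA β) * b (r - 1 - i))
      (fun β i => M.gC β * c i + M.hC β * d i),
    blockSeq r s (fun β i => M.fA β * b i + M.eA β * a (r - 1 - i))
      (fun β i => M.gC' β * d i + (-M.hC' β) * c i),
    blockSeq r s (fun β i => M.gA β * a i + (-M.hA β) * b i)
      (fun β i => (-M.fC β) * c i + (-M.eC β) * d (s - 1 - i)),
    blockSeq r s (fun β i => M.gA' β * b i + M.hA' β * a i)
      (fun β i => (-M.fC β) * d i + M.eC β * c (s - 1 - i))]
  refine ⟨X 0, X 1, X 2, X 3, isTSeq_of_unitQuadruple (X := X) (fun k hk => ?_)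
    (autocorr_sum_eq_zero _ X (w * v) ?_)⟩
  · have hn : 0 < r + s := Nat.pos_of_ne_zero fun h => by simp [h] at hk
    have hβ : k / (r + s) < N := (Nat.div_lt_iff_lt_mul hn).2 hk
    have hlt := Nat.mod_lt k hn
    simp only [X, Matrix.cons_val, blockSeq]
    split_ifs with h
    · have := (M.slotA _ hβ).unitQuadruple (hab _ h)
        (hab (r - 1 - k % (r + s)) (by lia))
      simpa only [neg_mul, ← sub_eq_add_neg] using this
    · have := (M.slotC _ hβ).unitQuadruple' (hcd (k % (r + s) - r) (by lia))
        (hcd (s - 1 - (k % (r + s) - r)) (by lia))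
      simpa only [neg_mul, ← sub_eq_add_neg] using this
  · have hneg (x : ℕ → ℤ) : seqPoly (r + s) N (fun β => -x β) = -seqPoly (r + s) N x := by
      simp [seqPoly]
    have hinv (x : ℤ[T;T⁻¹]) : invert (invert x) = x := involutive_invert x
    have hTT (x y : ℤ) : (T x : ℤ[T;T⁻¹]) * T y = T (x + y) := (T_add x y).symm
    rw [Int.cast_mul, ← hnorm, ← hv, Fin.sum_univ_four]
    simp only [X, Matrix.cons_val, seqPoly_blockSeq_linear, hneg, seqPoly_reverse, M.poly_fA,
      M.poly_eA, M.poly_gA, M.poly_gA', M.poly_hA, M.poly_hA', M.poly_gC', M.poly_hC', map_add,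
      map_mul, map_neg, hinv, invert_T]
    set n : ℤ := ((r + s : ℕ) : ℤ) with hn
    have key := @yang_lagrange_identity ℤ[T;T⁻¹] _ (seqPoly 1 r a) (seqPoly 1 r b)
      (seqPoly 1 s c) (seqPoly 1 s d) (seqPoly (r + s) N M.eC) (seqPoly (r + s) N M.fC)
      (seqPoly (r + s) N M.gC) (seqPoly (r + s) N M.hC) (invert (seqPoly 1 r a))
      (invert (seqPoly 1 r b)) (invert (seqPoly 1 s c)) (invert (seqPoly 1 s d))
      (invert (seqPoly (r + s) N M.eC)) (invert (seqPoly (r + s) N M.fC))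
      (invert (seqPoly (r + s) N M.gC)) (invert (seqPoly (r + s) N M.hC))
      (T (n * M.p)) (T (n * M.q) * T (((1 : ℕ) : ℤ) * (r - 1))) (T r)
      (T (n * (M.p + M.q - 1)) * T r) (T (n * M.p)) (T (n * (1 - M.q))) (T r)
      (T r * T (((1 : ℕ) : ℤ) * (s - 1)))
      (T (-(n * M.p))) (T (-(n * M.q)) * T (-(((1 : ℕ) : ℤ) * (r - 1)))) (T (-r))
      (T (-(n * (M.p + M.q - 1))) * T (-r)) (T (-(n * M.p))) (T (-(n * (1 - M.q)))) (T (-r))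
      (T (-r) * T (-(((1 : ℕ) : ℤ) * (s - 1))))
    simp only [hTT] at key
    simp only [← T_zero] at key
    rw [← key]
    · simp only [T_add]
      ring
    all_goals first | exact trivial | (congr 1; push_cast [hn]; ring)

lemma UnitPair.congr_left {x y x' y' : ℤ} (h : UnitPair x y) (h' : UnitPair x' y')
    (hx : x = 0 ↔ x' = 0) : UnitPair x' y := by
  simp only [UnitPair, Int.isUnit_iff] at *
  lia

/-- The sequence of length `m` given by `X`, moved to the positions `k, …, k + m - 1` and
extended by zeros. -/
def placeAt (k m : ℕ) (X : ℕ → ℤ) (i : ℕ) : ℤ :=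
  if k ≤ i ∧ i < k + m then X (i - k) else 0

lemma seqPoly_placeAt {d k m N : ℕ} (h : k + m ≤ N) (X : ℕ → ℤ) :
    seqPoly d N (placeAt k m X) = T ((d : ℤ) * k) * seqPoly d m X := by
  obtain ⟨N, rfl⟩ := Nat.exists_eq_add_of_le h
  rw [seqPoly, sum_range_add, sum_range_add, sum_eq_zero, zero_add, add_eq_left.2, seqPoly,
    mul_sum]
  · refine sum_congr rfl fun i hi => ?_
    rw [mem_range] at hi
    rw [placeAt, if_pos (by lia), mul_left_comm, ← T_add, Nat.add_sub_cancel_left]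
    congr 2
    push_cast
    ring
  · refine sum_eq_zero fun i _ => ?_
    rw [placeAt, if_neg (by lia)]
    simp
  · intro i hi
    rw [mem_range] at hi
    rw [placeAt, if_neg (by lia)]
    simp

/-- A multiplier from four sequences with vanishing total autocorrelation, where `x` and `y` are
supported in the even positions below `l`, respectively the odd positions and `l`, and `g`, `h`
have complementary symmetric supports. -/
def YangMultiplier.ofEven {l : ℕ} (hl : Even l) {x y g h : ℕ → ℤ}
    (hx : ∀ i < l, Even i → IsUnit (x i) ∧ y i = 0)
    (hy : ∀ i < l, ¬ Even i → x i = 0 ∧ IsUnit (y i))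
    (hxl : x l = 0) (hyl : IsUnit (y l))
    (hgh : ∀ i < l, UnitPair (g i) (h i)) (hsymm : ∀ i < l, g i = 0 ↔ g (l - 1 - i) = 0)
    (hcorr : ∀ j, 1 ≤ j →
      autocorr (l + 1) x j + autocorr (l + 1) y j + autocorr l g j + autocorr l h j = 0) :
    YangMultiplier (2 * l + 1) where
  fA := placeAt l (l + 1) fun i => y (l + 1 - 1 - i)
  eA := placeAt (l + 2) (l - 1) x
  gA := placeAt 0 l fun i => g (l - 1 - i)
  gA' := placeAt 0 l g
  hA := placeAt 0 l h
  hA' := placeAt 0 l fun i => h (l - 1 - i)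
  fC := placeAt 0 (l + 1) y
  eC := placeAt 0 (l + 1) x
  gC := placeAt (l + 1) l g
  gC' := placeAt (l + 1) l fun i => g (l - 1 - i)
  hC := placeAt (l + 1) l h
  hC' := placeAt (l + 1) l fun i => h (l - 1 - i)
  p := 2 * l
  q := l + 2
  slotA β hβ := by
    rcases lt_or_ge β l with hlt | hge
    · have h1 := hgh β hlt
      have h2 := hgh (l - 1 - β) (by lia)
      have h3 := hsymm β hlt
      right
      simp only [placeAt, Nat.zero_le, zero_add, hlt, Nat.not_le.2 hlt,
        show ¬ l + 2 ≤ β by lia, true_and, false_and, if_true, if_false, Nat.sub_zero]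
      exact ⟨h1.congr_left h2 h3, h2.congr_left h1 h3.symm, h3.symm⟩
    · left
      simp only [placeAt, Nat.zero_le, zero_add, hge, hge.not_gt, and_false, if_false,
        and_true, show β < l + (l + 1) by lia, if_true, UnitPair, Nat.add_sub_cancel]
      rcases eq_or_ne β l with rfl | h1
      · simp [hyl]
      · rcases eq_or_ne β (l + 1) with rfl | h2
        · simpa using (hy (l - 1) (by lia) (by grind)).2
        · rw [if_pos (by lia)]
          by_cases he : Even β
          · have e1 : Even (β - (l + 2)) := by grind
            have e2 : Even (l - (β - l)) := by grind
            exact Or.inr ⟨(hx _ (by lia) e2).2, (hx _ (by lia) e1).1⟩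
          · have e1 : ¬ Even (β - (l + 2)) := by grind
            have e2 : ¬ Even (l - (β - l)) := by grind
            exact Or.inl ⟨(hy _ (by lia) e2).2, (hy _ (by lia) e1).1⟩
  slotC β hβ := by
    rcases lt_or_ge l β with hlt | hge
    · have h1 := hgh (β - (l + 1)) (by lia)
      have h2 := hgh (l - 1 - (β - (l + 1))) (by lia)
      have h3 := hsymm (β - (l + 1)) (by lia)
      right
      simp only [placeAt, Nat.zero_le, zero_add, show ¬ β < l + 1 by lia, show l + 1 ≤ β by lia,
        show β < l + 1 + l by lia, true_and, if_true, if_false]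
      exact ⟨h1, h2, h3⟩
    · left
      simp only [placeAt, Nat.zero_le, zero_add, show β < l + 1 by lia,
        show ¬ l + 1 ≤ β by lia, false_and, if_false, if_true, and_true, UnitPair,
        Nat.sub_zero]
      rcases hge.eq_or_lt with rfl | h1
      · exact Or.inl ⟨hyl, hxl⟩
      · by_cases he : Even β
        · exact Or.inr ⟨(hx β h1 he).2, (hx β h1 he).1⟩
        · exact Or.inl ⟨(hy β h1 he).2, (hy β h1 he).1⟩
  poly_fA n := by
    rw [seqPoly_placeAt (by lia), seqPoly_placeAt (by lia), seqPoly_reverse, map_mul, invert_T,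
      ← mul_assoc, ← mul_assoc, ← T_add, ← T_add]
    congr 2
    push_cast
    ring
  poly_eA n := by
    rcases l with _ | l
    · simp [seqPoly, placeAt, hxl]
    · have h : seqPoly n (l + 1 + 1) x = seqPoly n l x := by
        have := (hy l (by lia) (by grind)).1
        rw [seqPoly, sum_range_succ, sum_range_succ, hxl, this]
        simp [seqPoly]
      rw [Nat.add_sub_cancel, seqPoly_placeAt (by lia), seqPoly_placeAt (by lia), ← mul_assoc,
        ← T_add, h]
      congr 3
  poly_gA n := by
    rw [seqPoly_placeAt (by lia), seqPoly_placeAt (by lia), seqPoly_reverse, map_mul, invert_T,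
      ← mul_assoc, ← mul_assoc, ← T_add, ← T_add]
    congr 2
    push_cast
    ring
  poly_hA' n := by
    rw [seqPoly_placeAt (by lia), seqPoly_placeAt (by lia), seqPoly_reverse, map_mul, invert_T,
      ← mul_assoc, ← mul_assoc, ← T_add, ← T_add]
    congr 2
    push_cast
    ring
  poly_gA' n := by
    rw [seqPoly_placeAt (by lia), seqPoly_placeAt (by lia), ← mul_assoc, ← T_add]
    congr 2
    push_cast
    ring
  poly_hA n := by
    rw [seqPoly_placeAt (by lia), seqPoly_placeAt (by lia), ← mul_assoc, ← T_add]
    congr 2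
    push_cast
    ring
  poly_gC' n := by
    rw [seqPoly_placeAt (by lia), seqPoly_placeAt (by lia), seqPoly_reverse, map_mul, invert_T,
      ← mul_assoc, ← mul_assoc, ← T_add, ← T_add]
    congr 2
    push_cast
    ring
  poly_hC' n := by
    rw [seqPoly_placeAt (by lia), seqPoly_placeAt (by lia), seqPoly_reverse, map_mul, invert_T,
      ← mul_assoc, ← mul_assoc, ← T_add, ← T_add]
    congr 2
    push_cast
    ring
  norm n := by
    have hT (k : ℤ) (P : ℤ[T;T⁻¹]) : T k * P * invert (T k * P) = P * invert P := by
      rw [map_mul, invert_T]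
      linear_combination P * invert P * T_mul_T_neg k
    have := seqPoly_norm_sum n (l + 1) ![l + 1, l + 1, l, l] ![x, y, g, h]
      (fun k => by fin_cases k <;> simp) fun j hj => by
        simpa only [Fin.sum_univ_four, Matrix.cons_val] using hcorr j hj
    simp only [Fin.sum_univ_four, Matrix.cons_val] at this
    rw [seqPoly_placeAt (by lia), seqPoly_placeAt (by lia), seqPoly_placeAt (by lia),
      seqPoly_placeAt (by lia), hT, hT, hT, hT]
    exact ⟨_, this⟩

lemma seqPoly_single {d m k : ℕ} (hk : k < m) :
    seqPoly d m (Pi.single k 1) = T ((d * k : ℕ) : ℤ) := by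
  rw [seqPoly, sum_eq_single_of_mem k (mem_range.2 hk)]
  · simp
  · intro i _ hi
    simp [Pi.single_eq_of_ne hi]

/-- The multiplier of Yang's multiplication by three. -/
def YangMultiplier.three : YangMultiplier 3 where
  fA := Pi.single 0 1
  eA := Pi.single 2 1
  gA := Pi.single 1 1
  gA' := Pi.single 1 1
  hA := 0
  hA' := 0
  fC := Pi.single 1 1
  eC := Pi.single 2 1
  gC := Pi.single 0 1
  gC' := Pi.single 0 1
  hC := 0
  hC' := 0
  p := 1
  q := 0
  slotA β hβ := by interval_cases β <;> simp [SlotCondition, UnitPair]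
  slotC β hβ := by interval_cases β <;> simp [SlotCondition, UnitPair]
  poly_fA n := by
    rw [seqPoly_single (by lia), seqPoly_single (by lia), invert_T, ← T_add]
    simp
  poly_eA n := by simp [seqPoly, sum_range_succ]
  poly_gA n := by simp [seqPoly, sum_range_succ]
  poly_hA' n := by simp [seqPoly]
  poly_gA' n := by simp [seqPoly, sum_range_succ]
  poly_hA n := by simp [seqPoly]
  poly_gC' n := by simp [seqPoly, sum_range_succ]
  poly_hC' n := by simp [seqPoly]
  norm n := ⟨3, by
    rw [seqPoly_single (by lia), seqPoly_single (by lia), seqPoly_single (by lia), invert_T,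
      invert_T, invert_T, T_mul_T_neg, T_mul_T_neg, T_mul_T_neg]
    simp [seqPoly]
    norm_num⟩

/-- The autocorrelation of two binary sequences modulo four depends only on their product. -/
lemma autocorr_add_modEq {m : ℕ} {A B : ℕ → ℤ} (hA : IsBinarySeq m A) (hB : IsBinarySeq m B)
    (j : ℕ) : autocorr m A j + autocorr m B j ≡
      ∑ i ∈ range (m - j), (A i * B i + A (m - 1 - i) * B (m - 1 - i)) [ZMOD 4] := by
  have hrefl : ∑ i ∈ range (m - j), A (m - 1 - i) * B (m - 1 - i) =
      ∑ i ∈ range (m - j), A (i + j) * B (i + j) := by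
    rw [← sum_range_reflect]
    refine sum_congr rfl fun i hi => ?_
    rw [mem_range] at hi
    rw [show m - 1 - (m - j - 1 - i) = i + j by lia]
  rw [sum_add_distrib, hrefl, autocorr, autocorr, ← sum_add_distrib, ← sum_add_distrib,
    Int.modEq_iff_dvd, ← sum_sub_distrib]
  refine dvd_sum fun i hi => ?_
  rw [mem_range] at hi
  rcases hA i (by lia) with h1 | h1 <;> rcases hB i (by lia) with h2 | h2 <;>
    rcases hA (i + j) (by lia) with h3 | h3 <;> rcases hB (i + j) (by lia) with h4 | h4 <;>
    norm_num [h1, h2, h3, h4]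

/-- The difference of the autocorrelation conditions of base sequences for two successive shifts,
modulo four. -/
lemma IsBaseSeq.mul_modEq {l : ℕ} {A B C D : ℕ → ℤ} (h : IsBaseSeq (l + 1) l A B C D) {m : ℕ}
    (hm : m + 1 < l) :
    A (m + 1) * B (m + 1) + A (l - 1 - m) * B (l - 1 - m) + C m * D m +
      C (l - 1 - m) * D (l - 1 - m) ≡ 0 [ZMOD 4] := by
  obtain ⟨hA, hB, hC, hD, hcorr⟩ := h
  have h1 := (autocorr_add_modEq hA hB (l - m)).add (autocorr_add_modEq hC hD (l - m))
  have h2 := (autocorr_add_modEq hA hB (l - m - 1)).add (autocorr_add_modEq hC hD (l - m - 1))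
  rw [← add_assoc, hcorr _ (by lia), show l + 1 - (l - m) = m + 1 by lia,
    show l - (l - m) = m by lia] at h1
  rw [← add_assoc, hcorr _ (by lia), show l + 1 - (l - m - 1) = m + 1 + 1 by lia,
    show l - (l - m - 1) = m + 1 by lia, sum_range_succ _ (m + 1),
    sum_range_succ _ m] at h2
  have h3 := (h2.sub h1).symm
  rw [sub_zero, show l + 1 - 1 - (m + 1) = l - 1 - m by lia] at h3
  convert h3 using 1
  rw [sum_range_succ _ m, sum_range_succ _ m]
  simp only [Nat.add_sub_cancel]
  ring

lemma IsNearNormalSeq.mul_eq {l : ℕ} {A B C D : ℕ → ℤ} (h : IsNearNormalSeq l A B C D) {i : ℕ}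
    (hi : i < l) : A i * B i = (-1) ^ i := by
  rw [h.2 i hi]
  rcases h.1.1 i (by lia) with h | h <;> simp [h]

lemma IsNearNormalSeq.mul_last {l : ℕ} {A B C D : ℕ → ℤ} (h : IsNearNormalSeq l A B C D)
    (hl : 0 < l) : B l = -A l := by
  have h0 := h.mul_eq hl
  obtain ⟨⟨hA, hB, hC, hD, hcorr⟩, -⟩ := h
  have h1 := (autocorr_add_modEq hA hB l).add (autocorr_add_modEq hC hD l)
  rw [← add_assoc, hcorr l hl] at h1
  simp only [Nat.add_sub_cancel_left, Nat.sub_self, sum_range_one, sum_range_zero, h0] at h1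
  rcases hA l (by lia) with h2 | h2 <;> rcases hB l (by lia) with h3 | h3 <;>
    simp [h2, h3, Int.ModEq] at h1 ⊢

lemma IsNearNormalSeq.even_or_eq_one {l : ℕ} {A B C D : ℕ → ℤ} (h : IsNearNormalSeq l A B C D) :
    Even l ∨ l = 1 := by
  by_contra! hl
  obtain ⟨k, rfl⟩ := Nat.not_even_iff_odd.1 hl.1
  have h1 := h.1.mul_modEq (m := k) (by lia)
  rw [show 2 * k + 1 - 1 - k = k by lia, h.mul_eq (by lia), h.mul_eq (by lia), pow_succ] at h1
  rcases h.1.2.2.1 k (by lia) with h2 | h2 <;> rcases h.1.2.2.2.1 k (by lia) with h3 | h3 <;>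
    simp [h2, h3, Int.ModEq] at h1

lemma IsNearNormalSeq.mul_symm {l : ℕ} {A B C D : ℕ → ℤ} (h : IsNearNormalSeq l A B C D)
    (hl : Even l) {i : ℕ} (hi : i < l) : C i * D i = C (l - 1 - i) * D (l - 1 - i) := by
  have key {i : ℕ} (hi : i + 1 < l) : C i * D i = C (l - 1 - i) * D (l - 1 - i) := by
    have h1 := h.1.mul_modEq hi
    rw [h.mul_eq hi, h.mul_eq (by lia), show (-1 : ℤ) ^ (l - 1 - i) = (-1) ^ (i + 1) from
      neg_one_pow_congr (by grind)] at h1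
    have h0 := neg_one_pow_eq_or ℤ (i + 1)
    rcases h0 with h0 | h0 <;>
    rcases h.1.2.2.1 i (by lia) with h2 | h2 <;> rcases h.1.2.2.2.1 i (by lia) with h3 | h3 <;>
    rcases h.1.2.2.1 (l - 1 - i) (by lia) with h4 | h4 <;>
    rcases h.1.2.2.2.1 (l - 1 - i) (by lia) with h5 | h5 <;>
    simp [h0, h2, h3, h4, h5, Int.ModEq] at h1 ⊢
  rcases eq_or_ne (i + 1) l with rfl | hne
  · have := key (i := 0) (by grind)
    simpa using this.symm
  · exact key (by lia)

lemma IsNearNormalSeq.nonempty_yangMultiplier {l : ℕ} {A B C D : ℕ → ℤ}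
    (h : IsNearNormalSeq l A B C D) : Nonempty (YangMultiplier (2 * l + 1)) := by
  rcases h.even_or_eq_one with hl | rfl
  swap
  · exact ⟨YangMultiplier.three⟩
  rcases l.eq_zero_or_pos with rfl | hpos
  · refine ⟨YangMultiplier.ofEven (x := 0) (y := 1) (g := 0) (h := 0) hl ?_ ?_ rfl isUnit_one
      ?_ ?_ fun j hj => ?_⟩ <;> simp [autocorr]
    lia
  have hAB := @h.mul_eq
  have hlast := h.mul_last hpos
  have hCD {i : ℕ} := h.mul_symm hl (i := i)
  obtain ⟨⟨hA, hB, hC, hD, hcorr⟩, -⟩ := h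
  obtain ⟨x, y, hAx, hBx, hxy, hxy'⟩ := exists_half_sum_diff hA hB
  obtain ⟨g, k, hCg, hDg, hgk, hgk'⟩ := exists_half_sum_diff hC hD
  have hyx {i : ℕ} (hi : i < l + 1) (hAB : A i = B i) : IsUnit (x i) ∧ y i = 0 := by
    have := hAx i hi
    have := hBx i hi
    rcases hxy i hi with h | h
    · exact h
    · exact absurd h.2 (by simp [show y i = 0 by lia])
  have hxy {i : ℕ} (hi : i < l + 1) (hAB : B i = -A i) : x i = 0 ∧ IsUnit (y i) := by
    have := hAx i hi
    have := hBx i hi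
    rcases hxy i hi with h | h
    · exact absurd h.1 (by simp [show x i = 0 by lia])
    · exact h
  have hg {i : ℕ} (hi : i < l) : g i = 0 ↔ C i * D i = -1 := by
    rw [hCg i hi, hDg i hi]
    rcases hgk i hi with ⟨h1, h2⟩ | ⟨h1, h2⟩
    · rcases Int.isUnit_iff.1 h1 with h1 | h1 <;> simp [h1, h2]
    · rcases Int.isUnit_iff.1 h2 with h2 | h2 <;> simp [h1, h2]
  refine ⟨YangMultiplier.ofEven (x := x) (y := y) (g := g) (h := k) hl (fun i hi he => ?_)
    (fun i hi ho => ?_) (hxy (by lia) hlast).1 (hxy (by lia) hlast).2 hgk (fun i hi => ?_)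
    fun j hj => ?_⟩
  · refine hyx (by lia) ?_
    have := hAB hi
    rw [he.neg_one_pow] at this
    rcases hA i (by lia) with h1 | h1 <;> rw [h1] at this ⊢ <;> lia
  · refine hxy (by lia) ?_
    have := hAB hi
    rw [(Nat.not_even_iff_odd.1 ho).neg_one_pow] at this
    rcases hA i (by lia) with h1 | h1 <;> rw [h1] at this ⊢ <;> lia
  · rw [hg hi, hg (by lia), hCD hi]
  · have := hcorr j hj
    have := hxy' j
    have := hgk' j
    lia

/-- Yang multiplication, second form: near-normal sequences
`NN(l)` and base sequences `BS(r,s)` yield T-sequences of length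
`(2l+1)(r+s)`. -/
theorem yang_multiplication_near_normal (l r s : ℕ)
    (hNN : ∃ A B C D : ℕ → ℤ, IsNearNormalSeq l A B C D)
    (hBS : ∃ A B C D : ℕ → ℤ, IsBaseSeq r s A B C D) :
    ∃ T₁ T₂ T₃ T₄ : ℕ → ℤ, IsTSeq ((2 * l + 1) * (r + s)) T₁ T₂ T₃ T₄ := by
  obtain ⟨A, B, C, D, h⟩ := hNN
  obtain ⟨M⟩ := h.nonempty_yangMultiplier
  exact M.exists_isTSeq hBS
end

section
/- If T-sequences of length t exist, then an orthogonal design OD(4t; t,t,t,t) exists, i.e., there exist four 4t×4t integer matrices A_1, A_2, A_3, A_4 with entries in {-1,0,1} whose supports are pairwise disjoint and whose supports together cover every matrix position, satisfying A_i A_i^T = t·I_{4t} for each i and A_i A_j^T + A_j A_i^T = 0 for all i ≠ j. -/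
open Finset Matrix Kronecker

lemma fin_four_rec {P : Fin 4 → Prop} (h0 : P 0) (h1 : P 1) (h2 : P 2) (h3 : P 3) (i : Fin 4) :
    P i := by
  fin_cases i <;> assumption

/-- The Goethals–Seidel array whose blocks are built from the circulant matrices of `a b c d`
and the reversal matrix `R`, the permutation matrix of `i ↦ -i`. -/
def goethalsSeidel {G : Type*} [AddCommGroup G] [Fintype G] [DecidableEq G] (a b c d : G → ℤ) :
    Matrix (Fin 4 × G) (Fin 4 × G) ℤ :=
  let A := circulant a
  let B := circulant b
  let C := circulant c
  let D := circulant d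
  let R : Matrix G G ℤ := (1 : Matrix G G ℤ).submatrix id Neg.neg
  Matrix.of fun x y =>
    (!![A, B * R, C * R, D * R;
        -(B * R), A, Dᵀ * R, -(Cᵀ * R);
        -(C * R), -(Dᵀ * R), A, Bᵀ * R;
        -(D * R), Cᵀ * R, -(Bᵀ * R), A] : Matrix (Fin 4) (Fin 4) (Matrix G G ℤ))
      x.1 y.1 x.2 y.2

section reversal

variable {G : Type*} [AddCommGroup G]

lemma mul_reversal_apply [Fintype G] [DecidableEq G] (M : Matrix G G ℤ) (i j : G) :
    (M * (1 : Matrix G G ℤ).submatrix id Neg.neg) i j = M i (-j) := by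
  simp [Matrix.mul_apply, Matrix.one_apply]

lemma reversal_transpose [DecidableEq G] :
    ((1 : Matrix G G ℤ).submatrix id Neg.neg)ᵀ = (1 : Matrix G G ℤ).submatrix id Neg.neg := by
  ext i j
  simp [Matrix.one_apply, eq_neg_iff_add_eq_zero, add_comm]

lemma reversal_mul_reversal [Fintype G] [DecidableEq G] :
    (1 : Matrix G G ℤ).submatrix id Neg.neg * (1 : Matrix G G ℤ).submatrix id Neg.neg = 1 := by
  ext i j
  simp [mul_reversal_apply, Matrix.one_apply]

lemma reversal_mul_circulant_transpose [Fintype G] [DecidableEq G] (v : G → ℤ) :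
    (1 : Matrix G G ℤ).submatrix id Neg.neg * (circulant v)ᵀ =
      circulant v * (1 : Matrix G G ℤ).submatrix id Neg.neg := by
  rw [← reversal_transpose, ← Matrix.transpose_mul, reversal_transpose]
  ext i j
  simp [mul_reversal_apply, add_comm]

lemma commute_circulant_transpose [Fintype G] (v w : G → ℤ) :
    circulant v * (circulant w)ᵀ = (circulant w)ᵀ * circulant v := by
  rw [transpose_circulant, circulant_mul_comm]

end reversal

lemma goethalsSeidel_apply {G : Type*} [AddCommGroup G] [Fintype G] [DecidableEq G]
    (a b c d : G → ℤ) (p q : Fin 4) (i j : G) :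
    goethalsSeidel a b c d (p, i) (q, j) =
      (!![a (i - j), b (i + j), c (i + j), d (i + j);
          -b (i + j), a (i - j), d (-j - i), -c (-j - i);
          -c (i + j), -d (-j - i), a (i - j), b (-j - i);
          -d (i + j), c (-j - i), -b (-j - i), a (i - j)] : Matrix (Fin 4) (Fin 4) ℤ) p q := by
  induction p using fin_four_rec <;> induction q using fin_four_rec <;>
    simp only [goethalsSeidel, Matrix.of_apply, Matrix.cons_val, Matrix.neg_apply,
      mul_reversal_apply, circulant_apply, transpose_apply, sub_neg_eq_add]

lemma mul_transpose_eq_of_blocks {ι G : Type*} [Fintype ι] [Fintype G]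
    (M : Matrix ι ι (Matrix G G ℤ)) (x y : ι × G) :
    ((Matrix.of fun x y : ι × G => M x.1 y.1 x.2 y.2) *
      (Matrix.of fun x y : ι × G => M x.1 y.1 x.2 y.2)ᵀ) x y =
      (∑ r, M x.1 r * (M y.1 r)ᵀ) x.2 y.2 := by
  simp [Matrix.mul_apply, Matrix.sum_apply, Fintype.sum_prod_type]

lemma goethalsSeidel_mul_transpose {G : Type*} [AddCommGroup G] [Fintype G] [DecidableEq G]
    (a b c d : G → ℤ) (n : ℤ)
    (h : circulant a * (circulant a)ᵀ + circulant b * (circulant b)ᵀ +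
      circulant c * (circulant c)ᵀ + circulant d * (circulant d)ᵀ = n • 1) :
    goethalsSeidel a b c d * (goethalsSeidel a b c d)ᵀ = n • 1 := by
  ext ⟨p, i⟩ ⟨q, j⟩
  unfold goethalsSeidel
  rw [mul_transpose_eq_of_blocks]
  trans (if p = q then n • 1 else 0 : Matrix G G ℤ) i j
  · refine congrArg (fun N : Matrix G G ℤ => N i j) ?_
    have hab := circulant_mul_comm a b
    have hac := circulant_mul_comm a c
    have had := circulant_mul_comm a d
    have hbc := circulant_mul_comm b c
    have hbd := circulant_mul_comm b d
    have hcd := circulant_mul_comm c d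
    have hab' := commute_circulant_transpose a b
    have hac' := commute_circulant_transpose a c
    have had' := commute_circulant_transpose a d
    have hbb' := commute_circulant_transpose b b
    have hcc' := commute_circulant_transpose c c
    have hdd' := commute_circulant_transpose d d
    have hbc' := commute_circulant_transpose b c
    have hbd' := commute_circulant_transpose b d
    have hcd' := commute_circulant_transpose c d
    have hcb' := commute_circulant_transpose c b
    have hdb' := commute_circulant_transpose d b
    have hdc' := commute_circulant_transpose d c
    have ra := reversal_mul_circulant_transpose a
    have rb := reversal_mul_circulant_transpose b
    have rc := reversal_mul_circulant_transpose c
    have rd := reversal_mul_circulant_transpose d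
    have rr := reversal_mul_reversal (G := G)
    have rt := reversal_transpose (G := G)
    generalize (1 : Matrix G G ℤ).submatrix id Neg.neg = R at *
    generalize circulant a = A at *
    generalize circulant b = B at *
    generalize circulant c = C at *
    generalize circulant d = D at *
    have key (Y : Matrix G G ℤ) : R * (R * Y) = Y := by
      rw [← mul_assoc, rr, one_mul]
    have swap {X : Matrix G G ℤ} (hX : R * Xᵀ = X * R) : R * X = Xᵀ * R := by
      rw [← mul_one (R * X), ← rr, ← mul_assoc, mul_assoc R, ← hX, key]
    have sb := swap rb
    have sc := swap rc
    have sd := swap rd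
    have hbc'' : Bᵀ * Cᵀ = Cᵀ * Bᵀ := by simp only [← transpose_mul, hbc]
    have hbd'' : Bᵀ * Dᵀ = Dᵀ * Bᵀ := by simp only [← transpose_mul, hbd]
    have hcd'' : Cᵀ * Dᵀ = Dᵀ * Cᵀ := by simp only [← transpose_mul, hcd]
    have assoc {X Y Z W : Matrix G G ℤ} (hXY : X * Y = Z * W) (U : Matrix G G ℤ) :
        X * (Y * U) = Z * (W * U) := by
      rw [← mul_assoc, hXY, mul_assoc]
    rw [← h]
    induction p using fin_four_rec <;> induction q using fin_four_rec <;>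
      simp only [Fin.sum_univ_four, Matrix.of_apply, Matrix.cons_val, transpose_mul, transpose_neg,
        transpose_transpose, mul_neg, neg_mul, neg_neg, mul_one, reduceIte, Fin.reduceEq, rt, rr,
        mul_assoc, ra, rb, rc, rd, sb, sc, sd, assoc rb, assoc rc, assoc rd, assoc sb, assoc sc,
        assoc sd, hbc, hbd, hcd, hbb', hcc', hdd', hbc', hbd', hcd', hcb', hdb', hdc', hbc'', hbd'',
        hcd'', assoc hab, assoc hac, assoc had, assoc hab', assoc hac', assoc had'] <;>
      abel
  · by_cases hpq : p = q <;> simp [hpq, Matrix.one_apply]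

/-- The `r`-th first-row sequence obtained by applying the quaternionic orthogonal design
`OD(4; 1, 1, 1, 1)` in the variables `v` to four sequences. -/
def quatSeq {G : Type*} (v : Fin 4 → ℤ) (T₁ T₂ T₃ T₄ : G → ℤ) : Fin 4 → G → ℤ :=
  ![fun g => v 0 * T₁ g + v 1 * T₂ g + v 2 * T₃ g + v 3 * T₄ g,
    fun g => -v 1 * T₁ g + v 0 * T₂ g + v 3 * T₃ g - v 2 * T₄ g,
    fun g => -v 2 * T₁ g - v 3 * T₂ g + v 0 * T₃ g + v 1 * T₄ g,
    fun g => -v 3 * T₁ g + v 2 * T₂ g - v 1 * T₃ g + v 0 * T₄ g]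

/-- The Goethals–Seidel array of the four sequences `quatSeq v T₁ T₂ T₃ T₄`. -/
def quatArray {G : Type*} [AddCommGroup G] [Fintype G] [DecidableEq G] (T₁ T₂ T₃ T₄ : G → ℤ)
    (v : Fin 4 → ℤ) : Matrix (Fin 4 × G) (Fin 4 × G) ℤ :=
  goethalsSeidel (quatSeq v T₁ T₂ T₃ T₄ 0) (quatSeq v T₁ T₂ T₃ T₄ 1)
    (quatSeq v T₁ T₂ T₃ T₄ 2) (quatSeq v T₁ T₂ T₃ T₄ 3)

section quatArray

variable {G : Type*} [AddCommGroup G] [Fintype G] [DecidableEq G] (T₁ T₂ T₃ T₄ : G → ℤ)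

lemma quatArray_add (v w : Fin 4 → ℤ) :
    quatArray T₁ T₂ T₃ T₄ (v + w) = quatArray T₁ T₂ T₃ T₄ v + quatArray T₁ T₂ T₃ T₄ w := by
  ext ⟨p, i⟩ ⟨q, j⟩
  induction p using fin_four_rec <;> induction q using fin_four_rec <;>
    simp only [quatArray, goethalsSeidel_apply, quatSeq, Matrix.of_apply, Matrix.cons_val,
      Pi.add_apply, Matrix.add_apply] <;> ring

lemma quatArray_mul_transpose (n : ℤ)
    (h : ∀ s, ∑ g, (T₁ g * T₁ (g + s) + T₂ g * T₂ (g + s) + T₃ g * T₃ (g + s) +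
      T₄ g * T₄ (g + s)) = if s = 0 then n else 0) (v : Fin 4 → ℤ) :
    quatArray T₁ T₂ T₃ T₄ v * (quatArray T₁ T₂ T₃ T₄ v)ᵀ = ((∑ k, v k ^ 2) * n) • 1 := by
  apply goethalsSeidel_mul_transpose
  ext i j
  simp only [Matrix.add_apply, Matrix.mul_apply, Matrix.transpose_apply, circulant_apply,
    ← Finset.sum_add_distrib]
  have hs := h (j - i)
  rw [← (Equiv.subLeft i).sum_comp] at hs
  simp only [Equiv.subLeft_apply, sub_add_sub_cancel', sub_eq_zero] at hs
  trans (∑ k, v k ^ 2) * if j = i then n else 0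
  · rw [← hs, Finset.mul_sum]
    refine Finset.sum_congr rfl fun k _ => ?_
    simp [quatSeq, Fin.sum_univ_four]
    ring
  · simp [Matrix.one_apply, eq_comm]

lemma quatArray_single_mem (h : ∀ g, T₁ g ∈ ({-1, 0, 1} : Set ℤ) ∧ T₂ g ∈ ({-1, 0, 1} : Set ℤ) ∧
      T₃ g ∈ ({-1, 0, 1} : Set ℤ) ∧ T₄ g ∈ ({-1, 0, 1} : Set ℤ)) (k : Fin 4) (x y : Fin 4 × G) :
    quatArray T₁ T₂ T₃ T₄ (Pi.single k 1) x y ∈ ({-1, 0, 1} : Set ℤ) := by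
  obtain ⟨p, i⟩ := x
  obtain ⟨q, j⟩ := y
  simp only [Set.mem_insert_iff, Set.mem_singleton_iff] at h ⊢
  induction p using fin_four_rec <;> induction q using fin_four_rec <;>
    induction k using fin_four_rec <;>
    simp only [quatArray, goethalsSeidel_apply, quatSeq, Matrix.of_apply, Matrix.cons_val,
      Pi.single_apply, Fin.reduceEq, reduceIte] <;> grind

lemma existsUnique_quatArray_single_ne_zero
    (h : ∀ g, (T₁ g ≠ 0 ∧ T₂ g = 0 ∧ T₃ g = 0 ∧ T₄ g = 0) ∨
      (T₁ g = 0 ∧ T₂ g ≠ 0 ∧ T₃ g = 0 ∧ T₄ g = 0) ∨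
      (T₁ g = 0 ∧ T₂ g = 0 ∧ T₃ g ≠ 0 ∧ T₄ g = 0) ∨
      (T₁ g = 0 ∧ T₂ g = 0 ∧ T₃ g = 0 ∧ T₄ g ≠ 0)) (x y : Fin 4 × G) :
    ∃! k, quatArray T₁ T₂ T₃ T₄ (Pi.single k 1) x y ≠ 0 := by
  obtain ⟨p, i⟩ := x
  obtain ⟨q, j⟩ := y
  have key (f : Fin 4 → ℤ) (hf : (f 0 ≠ 0 ∧ f 1 = 0 ∧ f 2 = 0 ∧ f 3 = 0) ∨
      (f 0 = 0 ∧ f 1 ≠ 0 ∧ f 2 = 0 ∧ f 3 = 0) ∨ (f 0 = 0 ∧ f 1 = 0 ∧ f 2 ≠ 0 ∧ f 3 = 0) ∨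
      (f 0 = 0 ∧ f 1 = 0 ∧ f 2 = 0 ∧ f 3 ≠ 0)) : ∃! k, f k ≠ 0 := by
    rcases hf with h | h | h | h
    · exact ⟨0, h.1, fun k hk => by fin_cases k <;> simp_all⟩
    · exact ⟨1, h.2.1, fun k hk => by fin_cases k <;> simp_all⟩
    · exact ⟨2, h.2.2.1, fun k hk => by fin_cases k <;> simp_all⟩
    · exact ⟨3, h.2.2.2, fun k hk => by fin_cases k <;> simp_all⟩
  apply key
  induction p using fin_four_rec <;> induction q using fin_four_rec <;>
    simp only [quatArray, goethalsSeidel_apply, quatSeq, Matrix.of_apply, Matrix.cons_val,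
      Pi.single_apply, Fin.reduceEq, reduceIte] <;> grind

end quatArray

lemma sum_mul_add_eq_autocorr (n : ℕ) (T : ℕ → ℤ) (s : Fin (n + 1)) (hs : s ≠ 0) :
    ∑ g : Fin (n + 1), T g * T ((g + s : Fin (n + 1)) : ℕ) =
      autocorr (n + 1) T s + autocorr (n + 1) T (n + 1 - s) := by
  simp only [Fin.val_add]
  rw [Fin.sum_univ_eq_sum_range (fun k => T k * T ((k + s) % (n + 1))) (n + 1)]
  have h0 : (s : ℕ) ≠ 0 := fun h => hs (Fin.ext h)
  clear hs
  obtain ⟨r, hr⟩ := s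
  generalize n + 1 = N at *
  obtain ⟨m, rfl⟩ : ∃ m, N = m + r := ⟨N - r, by omega⟩
  simp only [autocorr, Finset.sum_range_add, Nat.add_sub_cancel, Nat.add_sub_cancel_left]
  congr 1
  · refine Finset.sum_congr rfl fun k hk => ?_
    rw [Nat.mod_eq_of_lt (by have := Finset.mem_range.1 hk; omega)]
  · refine Finset.sum_congr rfl fun k hk => ?_
    rw [show m + k + r = k + (m + r) by ring, Nat.add_mod_right,
      Nat.mod_eq_of_lt (by have := Finset.mem_range.1 hk; omega), add_comm m k, mul_comm]

lemma IsTSeq.sum_mul_add {n : ℕ} {T₁ T₂ T₃ T₄ : ℕ → ℤ} (h : IsTSeq (n + 1) T₁ T₂ T₃ T₄)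
    (s : Fin (n + 1)) :
    ∑ g : Fin (n + 1), (T₁ g * T₁ (g + s : Fin (n + 1)) + T₂ g * T₂ (g + s : Fin (n + 1)) +
      T₃ g * T₃ (g + s : Fin (n + 1)) + T₄ g * T₄ (g + s : Fin (n + 1))) =
      if s = 0 then ((n + 1 : ℕ) : ℤ) else 0 := by
  obtain ⟨h1, h2, h3, h4, hd, hN⟩ := h
  split_ifs with hs
  · subst hs
    simp only [Set.mem_insert_iff, Set.mem_singleton_iff] at h1 h2 h3 h4
    rw [Finset.sum_congr rfl (g := fun _ => (1 : ℤ))]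
    · simp
    · intro g _
      have g1 := h1 g g.isLt
      have g2 := h2 g g.isLt
      have g3 := h3 g g.isLt
      have g4 := h4 g g.isLt
      have gd := hd g g.isLt
      rw [add_zero]
      grind
  · have h0 : (s : ℕ) ≠ 0 := fun h => hs (Fin.ext h)
    have hlt := s.isLt
    simp only [Finset.sum_add_distrib, sum_mul_add_eq_autocorr n _ s hs]
    linarith [hN s (by omega), hN (n + 1 - s) (by omega)]

/-- If T-sequences of length `t` exist, then an orthogonal design
`OD(4t; t,t,t,t)` exists. -/
theorem T_seq_to_orthogonal_design (t : ℕ)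
    (h : ∃ T₁ T₂ T₃ T₄ : ℕ → ℤ, IsTSeq t T₁ T₂ T₃ T₄) :
    ∃ A : Fin 4 → Matrix (Fin (4 * t)) (Fin (4 * t)) ℤ, IsOD t A := by
  obtain ⟨T₁, T₂, T₃, T₄, hT⟩ := h
  rcases t with _ | n
  · exact ⟨fun _ => 0, fun _ i => i.elim0, fun i => i.elim0, fun _ => by ext i; exact i.elim0,
      fun _ _ _ => by ext i; exact i.elim0⟩
  let M := quatArray (fun g : Fin (n + 1) => T₁ g) (fun g => T₂ g) (fun g => T₃ g) (fun g => T₄ g)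
  let e : Fin (4 * (n + 1)) ≃ Fin 4 × Fin (n + 1) := finProdFinEquiv.symm
  have hM := quatArray_mul_transpose (fun g : Fin (n + 1) => T₁ g) (fun g => T₂ g)
    (fun g => T₃ g) (fun g => T₄ g) _ hT.sum_mul_add
  have hself (k : Fin 4) : M (Pi.single k 1) * (M (Pi.single k 1))ᵀ = ((n + 1 : ℕ) : ℤ) • 1 := by
    rw [hM, Finset.sum_eq_single k (by simp +contextual) (by simp)]
    simp
  refine ⟨fun k => (M (Pi.single k 1)).submatrix e e, fun k i j => ?_, fun i j => ?_,
    fun k => ?_, fun k l hkl => ?_⟩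
  · exact quatArray_single_mem _ _ _ _ (fun g : Fin (n + 1) => ⟨hT.1 g g.isLt, hT.2.1 g g.isLt,
      hT.2.2.1 g g.isLt, hT.2.2.2.1 g g.isLt⟩) k (e i) (e j)
  · exact existsUnique_quatArray_single_ne_zero _ _ _ _
      (fun g : Fin (n + 1) => hT.2.2.2.2.1 g g.isLt) (e i) (e j)
  · rw [transpose_submatrix, submatrix_mul_equiv, hself]
    ext i j
    simp only [submatrix_apply, Matrix.smul_apply, Matrix.one_apply, e.injective.eq_iff]
  · have hsum : ∑ m, (Pi.single k 1 + Pi.single l 1 : Fin 4 → ℤ) m ^ 2 = 2 := by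
      revert k l
      decide
    have hkl' := hM (Pi.single k 1 + Pi.single l 1)
    rw [quatArray_add, transpose_add, hsum] at hkl'
    have hzero : M (Pi.single k 1) * (M (Pi.single l 1))ᵀ +
        M (Pi.single l 1) * (M (Pi.single k 1))ᵀ = 0 := by
      have hk := hself k
      have hl := hself l
      simp only [M] at hk hl ⊢
      rw [add_mul, mul_add, mul_add, hk, hl, mul_smul, two_smul] at hkl'
      rw [← sub_eq_zero.2 hkl']
      abel
    rw [transpose_submatrix, transpose_submatrix, submatrix_mul_equiv, submatrix_mul_equiv]
    exact congrArg (fun N => N.submatrix e e) hzero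
end

section
/- Let A_1, A_2, A_3, A_4 be the coefficient matrices of an orthogonal design OD(4d; d,d,d,d), i.e., 4d×4d matrices with entries in {-1,0,1}, pairwise disjoint supports whose union is all positions, A_i A_i^T = d·I_{4d} for each i, and A_i A_j^T + A_j A_i^T = 0 for i ≠ j. Let W_1, W_2, W_3, W_4 be Williamson-type matrices of order w, i.e., w×w matrices with entries in {1,-1} satisfying W_i W_j^T = W_j W_i^T for all i,j and W_1 W_1^T + W_2 W_2^T + W_3 W_3^T + W_4 W_4^T = 4w·I_w. Then the matrix H = Σ_{i=1}^{4} A_i ⊗ W_i (Kronecker product) is a Hadamard matrix of order 4dw. -/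
open Finset Matrix Kronecker

/-- A double sum of terms that are antisymmetric off the diagonal reduces to the diagonal. -/
theorem sum_sum_eq_sum_diag_of_antisymm {ι M : Type*} [Fintype ι] [AddCommGroup M]
    [IsAddTorsionFree M] (f : ι → ι → M) (hf : ∀ k l, k ≠ l → f k l + f l k = 0) :
    ∑ k, ∑ l, f k l = ∑ k, f k k := by
  classical
  apply nsmul_right_injective two_ne_zero
  change 2 • _ = 2 • _
  calc 2 • ∑ k, ∑ l, f k l = ∑ k, ∑ l, (f k l + f l k) := by
        simp_rw [Finset.sum_add_distrib]
        rw [Finset.sum_comm (f := fun k l => f l k), two_nsmul]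
    _ = ∑ k, (f k k + f k k) := by
        refine Finset.sum_congr rfl fun k _ => ?_
        exact Finset.sum_eq_single k (fun l _ hl => hf k l hl.symm) (by simp)
    _ = 2 • ∑ k, f k k := by rw [Finset.sum_add_distrib, two_nsmul]

/-- The Gram matrix of `∑ k, A k ⊗ₖ W k` for anti-amicable `A k` with `A k * (A k)ᵀ = d • 1` and
pairwise amicable `W k`. -/
theorem sum_kronecker_mul_transpose {ι m n : Type*} [Fintype ι] [Fintype m] [DecidableEq m]
    [Fintype n] (d : ℤ) (A : ι → Matrix m m ℤ) (W : ι → Matrix n n ℤ)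
    (hAA : ∀ k, A k * (A k)ᵀ = d • 1)
    (hA : ∀ k l, k ≠ l → A k * (A l)ᵀ + A l * (A k)ᵀ = 0)
    (hW : ∀ k l, W k * (W l)ᵀ = W l * (W k)ᵀ) :
    (∑ k, A k ⊗ₖ W k) * (∑ k, A k ⊗ₖ W k)ᵀ =
      (d • (1 : Matrix m m ℤ)) ⊗ₖ (∑ k, W k * (W k)ᵀ) := by
  have : IsAddTorsionFree (Matrix (m × n) (m × n) ℤ) :=
    inferInstanceAs (IsAddTorsionFree (m × n → m × n → ℤ))
  have key := sum_sum_eq_sum_diag_of_antisymm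
    (fun k l => (A k * (A l)ᵀ) ⊗ₖ (W k * (W l)ᵀ)) fun k l hkl => by
      simp only [hW l k, ← Matrix.add_kronecker, hA k l hkl, Matrix.zero_kronecker]
  simp only [Matrix.transpose_sum, Finset.sum_mul_sum, ← Matrix.kroneckerMap_transpose,
    ← Matrix.mul_kronecker_mul, key, hAA]
  exact (map_sum (Matrix.kroneckerBilinear (R := ℤ) (α := ℤ) (d • (1 : Matrix m m ℤ))) _ _).symm

/-- Plugging Williamson-type matrices of order `w` into an
orthogonal design `OD(4d; d,d,d,d)` via `H = ∑ᵢ Aᵢ ⊗ Wᵢ` produces a Hadamard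
matrix of order `4dw`. -/
theorem od_williamson_to_hadamard (d w : ℕ)
    (A : Fin 4 → Matrix (Fin (4 * d)) (Fin (4 * d)) ℤ)
    (W : Fin 4 → Matrix (Fin w) (Fin w) ℤ)
    (hA : IsOD d A) (hW : IsWilliamsonType w W) :
    IsHadamardMatrix (∑ k, A k ⊗ₖ W k) ∧
      Fintype.card (Fin (4 * d) × Fin w) = 4 * d * w := by
  obtain ⟨hA01, hAsupp, hAA, hAanti⟩ := hA
  obtain ⟨hW1, hWamic, hWsum⟩ := hW
  refine ⟨⟨?_, ?_⟩, by simp⟩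
  · rintro ⟨i, p⟩ ⟨j, q⟩
    obtain ⟨k, hk, huniq⟩ := hAsupp i j
    have hentry : (∑ l, A l ⊗ₖ W l) (i, p) (j, q) = A k i j * W k p q := by
      simp only [Matrix.sum_apply, Matrix.kroneckerMap_apply]
      refine Finset.sum_eq_single k (fun l _ hl => ?_) (by simp)
      rw [not_not.mp fun h => hl (huniq l h), zero_mul]
    rw [hentry]
    rcases hA01 k i j with h | h | h
    · rcases hW1 k p q with h' | h' <;> simp [h, h']
    · exact absurd h hk
    · rcases hW1 k p q with h' | h' <;> simp [Set.mem_singleton_iff.mp h, h']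
  · rw [sum_kronecker_mul_transpose (d : ℤ) A W hAA hAanti hWamic, hWsum,
      Matrix.smul_kronecker, Matrix.kronecker_smul, Matrix.one_kronecker_one, smul_smul]
    congr 1
    simp only [Fintype.card_prod, Fintype.card_fin]
    push_cast
    ring
end
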